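/- Let g : R → R be Lipschitz with g(0) = 0 and with Lipschitz constant L, and let h : (0,∞) → (0,∞) be continuous with minimum value on the relevant σ's denoted h_min := min_j h(σ_j) satisfying h_min > L, where σ_1,...,σ_N > 0 are fixed. Then F(X) := Σ_{j=1}^N ( h(σ_j) e_j(X) + g(e_j(X)) ) is uniformly elliptic: M⁻_{λ,Λ}(X−Y) ≤ F(X) − F(Y) ≤ M⁺_{λ,Λ}(X−Y) for all X, Y ∈ Sym(N), with λ = h_min − L and Λ = max_j h(σ_j) + L. -/

import Mathlib

open Finset

/-- Eigenvalues of a real matrix (zero if the matrix is not symmetric). -/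
noncomputable def eigs {N : ℕ} (Y : Matrix (Fin N) (Fin N) ℝ) : Fin N → ℝ :=
  if h : Y.IsHermitian then h.eigenvalues else 0

/-- Pucci maximal operator M⁺_{λ,Λ}. -/
noncomputable def pucciPlus (lam Lam : ℝ) {N : ℕ} (Y : Matrix (Fin N) (Fin N) ℝ) : ℝ :=
  ∑ i, (Lam * max (eigs Y i) 0 + lam * min (eigs Y i) 0)

/-- Pucci minimal operator M⁻_{λ,Λ}. -/
noncomputable def pucciMinus (lam Lam : ℝ) {N : ℕ} (Y : Matrix (Fin N) (Fin N) ℝ) : ℝ :=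
  ∑ i, (lam * max (eigs Y i) 0 + Lam * min (eigs Y i) 0)

open Matrix in
/-- Diagonalization with an explicit orthogonal matrix. -/
lemma exists_diag {N : ℕ} {A : Matrix (Fin N) (Fin N) ℝ} (hA : A.IsHermitian) :
    ∃ U : Matrix (Fin N) (Fin N) ℝ, U * Uᵀ = 1 ∧ Uᵀ * U = 1 ∧
      A = U * diagonal (eigs A) * Uᵀ := by
  refine ⟨hA.eigenvectorUnitary, ?_, ?_, ?_⟩
  · have := Unitary.coe_mul_star_self hA.eigenvectorUnitary
    simpa [star_eq_conjTranspose] using this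
  · have := Unitary.coe_star_mul_self hA.eigenvectorUnitary
    simpa [star_eq_conjTranspose] using this
  · have := hA.spectral_theorem
    rw [Unitary.conjStarAlgAut_apply] at this
    have e : eigs A = hA.eigenvalues := dif_pos hA
    rw [e]
    simpa [star_eq_conjTranspose, Function.comp_def] using this

open Matrix in
lemma quad_diag {N : ℕ} (U : Matrix (Fin N) (Fin N) ℝ) (d : Fin N → ℝ) (v : Fin N → ℝ) :
    v ⬝ᵥ ((U * diagonal d * Uᵀ) *ᵥ v) = ∑ j, d j * (Uᵀ *ᵥ v) j ^ 2 := by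
  rw [← mulVec_mulVec, ← mulVec_mulVec, dotProduct_mulVec, ← mulVec_transpose]
  simp only [dotProduct, mulVec_diagonal]
  exact Finset.sum_congr rfl fun j _ => by ring

open Matrix in
lemma quad_one {N : ℕ} (U : Matrix (Fin N) (Fin N) ℝ) (hU : U * Uᵀ = 1) (v : Fin N → ℝ) :
    v ⬝ᵥ v = ∑ j, (Uᵀ *ᵥ v) j ^ 2 := by
  have := quad_diag U (fun _ => 1) v
  rw [diagonal_one, mul_one, hU, one_mulVec] at this
  simpa using this

/-- A common order on indices for which all eigenvalue families are antitone. -/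
lemma exists_rank (N : ℕ) : ∃ r : Fin N → ℕ, Function.Injective r ∧
    ∀ A : Matrix (Fin N) (Fin N) ℝ, ∀ i j, r i ≤ r j → eigs A j ≤ eigs A i := by
  refine ⟨fun i => ((Fintype.equivOfCardEq (Fintype.card_fin _) :
    Fin (Fintype.card (Fin N)) ≃ Fin N).symm i : ℕ), ?_, ?_⟩
  · intro i j hij
    exact (Equiv.injective _) (Fin.ext hij)
  · intro A i j hij
    unfold eigs
    split_ifs with hA
    · exact hA.eigenvalues₀_antitone (Fin.le_def.2 hij)
    · simp

open Matrix in
/-- Weyl monotonicity. -/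
lemma eigs_mono {N : ℕ} {A B : Matrix (Fin N) (Fin N) ℝ} (hA : A.IsHermitian)
    (hB : B.IsHermitian) (hAB : ∀ v : Fin N → ℝ, v ⬝ᵥ (A *ᵥ v) ≤ v ⬝ᵥ (B *ᵥ v)) (i : Fin N) :
    eigs A i ≤ eigs B i := by
  obtain ⟨r, hr, hanti⟩ := exists_rank N
  obtain ⟨U, hU, -, hUA⟩ := exists_diag hA
  obtain ⟨V, hV, -, hVB⟩ := exists_diag hB
  let M : Matrix (Fin N) (Fin N) ℝ := fun j =>
    if r i < r j then Uᵀ j else if r j < r i then Vᵀ j else 0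
  have hM : M.det = 0 := det_eq_zero_of_row_eq_zero i (fun k => by simp [M])
  obtain ⟨v, hv0, hv⟩ := exists_mulVec_eq_zero_iff.2 hM
  have hUv : ∀ j, r i < r j → (Uᵀ *ᵥ v) j = 0 := fun j hj => by
    have := congrFun hv j
    simpa [mulVec, M, hj] using this
  have hVv : ∀ j, r j < r i → (Vᵀ *ᵥ v) j = 0 := fun j hj => by
    have := congrFun hv j
    simpa [mulVec, M, hj, hj.le, not_lt.2 hj.le] using this
  have h1 : eigs A i * (v ⬝ᵥ v) ≤ v ⬝ᵥ (A *ᵥ v) := by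
    conv_rhs => rw [hUA]
    rw [quad_diag, quad_one U hU, Finset.mul_sum]
    refine Finset.sum_le_sum fun j _ => ?_
    rcases lt_or_ge (r i) (r j) with hj | hj
    · simp [hUv j hj]
    · exact mul_le_mul_of_nonneg_right (hanti A j i hj) (sq_nonneg _)
  have h2 : v ⬝ᵥ (B *ᵥ v) ≤ eigs B i * (v ⬝ᵥ v) := by
    conv_lhs => rw [hVB]
    rw [quad_diag, quad_one V hV, Finset.mul_sum]
    refine Finset.sum_le_sum fun j _ => ?_
    rcases lt_or_ge (r j) (r i) with hj | hj
    · simp [hVv j hj]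
    · exact mul_le_mul_of_nonneg_right (hanti B i j hj) (sq_nonneg _)
  have hpos : 0 < v ⬝ᵥ v := by
    have := dotProduct_star_self_pos_iff.2 hv0
    simpa using this
  exact le_of_mul_le_mul_right (h1.trans ((hAB v).trans h2)) hpos

lemma sum_eigs {N : ℕ} {A : Matrix (Fin N) (Fin N) ℝ} (hA : A.IsHermitian) :
    ∑ i, eigs A i = A.trace := by
  have := hA.trace_eq_sum_eigenvalues
  have e : eigs A = hA.eigenvalues := dif_pos hA
  simp [this, e]

open Matrix in
lemma sum_pos_le {N : ℕ} {X Y : Matrix (Fin N) (Fin N) ℝ} (hX : X.IsHermitian)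
    (hY : Y.IsHermitian) :
    ∑ i, max (eigs X i - eigs Y i) 0 ≤ ∑ i, max (eigs (X - Y) i) 0 := by
  obtain ⟨U, hU, hU', hZ⟩ := exists_diag (hX.sub hY)
  set z := eigs (X - Y) with hz
  set P := U * diagonal (fun i => max (z i) 0) * Uᵀ with hP
  have hPh : P.IsHermitian := by
    simp [hP, IsHermitian, conjTranspose_eq_transpose_of_trivial, Matrix.mul_assoc]
  have hYP := hY.add hPh
  have htr : P.trace = ∑ i, max (z i) 0 := by
    rw [hP, trace_mul_comm, ← Matrix.mul_assoc, hU', one_mul, trace_diagonal]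
  have hPnn : ∀ v, 0 ≤ v ⬝ᵥ (P *ᵥ v) := fun v => by
    rw [hP, quad_diag]
    exact Finset.sum_nonneg fun j _ => mul_nonneg (le_max_right _ _) (sq_nonneg _)
  have hZP : ∀ v, v ⬝ᵥ ((X - Y) *ᵥ v) ≤ v ⬝ᵥ (P *ᵥ v) := fun v => by
    rw [hZ, hP, quad_diag, quad_diag]
    exact Finset.sum_le_sum fun j _ =>
      mul_le_mul_of_nonneg_right (le_max_left _ _) (sq_nonneg _)
  have m1 := eigs_mono hX hYP (fun v => by
    have := hZP v
    rw [sub_mulVec, dotProduct_sub] at this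
    rw [add_mulVec, dotProduct_add]
    linarith)
  have m2 := eigs_mono hY hYP (fun v => by
    have := hPnn v
    rw [add_mulVec, dotProduct_add]
    linarith)
  calc ∑ i, max (eigs X i - eigs Y i) 0 ≤ ∑ i, (eigs (Y + P) i - eigs Y i) :=
        Finset.sum_le_sum fun i _ => max_le (by linarith [m1 i]) (by linarith [m2 i])
    _ = ∑ i, max (z i) 0 := by
        rw [Finset.sum_sub_distrib, sum_eigs hYP, sum_eigs hY, trace_add, htr]; ring

/-- F(X) = Σ_j (h(σ_j)e_j(X) + g(e_j(X))), for g Lipschitz with g(0)=0 and constant L,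
and h continuous positive with h_min := min_j h(σ_j) > L, is uniformly elliptic with
λ = h_min − L, Λ = max_j h(σ_j) + L. -/
theorem stmt15 {N : ℕ} (hN : 0 < N) (L : ℝ) (hL : 0 ≤ L)
    (g : ℝ → ℝ) (hg : ∀ s t : ℝ, |g s - g t| ≤ L * |s - t|) (hg0 : g 0 = 0)
    (h : ℝ → ℝ) (hh : ContinuousOn h (Set.Ioi 0)) (hhpos : ∀ t > (0 : ℝ), 0 < h t)
    (σ : Fin N → ℝ) (hσ : ∀ j, 0 < σ j)
    (hmin hmax : ℝ)
    (hhmin : IsLeast (Set.range fun j => h (σ j)) hmin)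
    (hhmax : IsGreatest (Set.range fun j => h (σ j)) hmax)
    (hminL : L < hmin)
    (F : Matrix (Fin N) (Fin N) ℝ → ℝ)
    (hF : F = fun X => ∑ j, (h (σ j) * eigs X j + g (eigs X j))) :
    ∀ X Y : Matrix (Fin N) (Fin N) ℝ, X.IsHermitian → Y.IsHermitian →
      pucciMinus (hmin - L) (hmax + L) (X - Y) ≤ F X - F Y ∧
      F X - F Y ≤ pucciPlus (hmin - L) (hmax + L) (X - Y) := by
  intro X Y hX hY
  have key := sum_pos_le hX hY
  have htr : ∑ i, (eigs X i - eigs Y i) = ∑ i, eigs (X - Y) i := by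
    rw [Finset.sum_sub_distrib, sum_eigs hX, sum_eigs hY, sum_eigs (hX.sub hY), Matrix.trace_sub]
  have hlo : ∀ j, hmin ≤ h (σ j) := fun j => hhmin.2 ⟨j, rfl⟩
  have hhi : ∀ j, h (σ j) ≤ hmax := fun j => hhmax.2 ⟨j, rfl⟩
  have hle : hmin ≤ hmax := (hlo ⟨0, hN⟩).trans (hhi _)
  have hFd : F X - F Y = ∑ j, (h (σ j) * (eigs X j - eigs Y j)
      + (g (eigs X j) - g (eigs Y j))) := by
    rw [hF]
    simp only [← Finset.sum_sub_distrib]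
    exact Finset.sum_congr rfl fun j _ => by ring
  have hmm : ∀ t : ℝ, min t 0 = t - max t 0 := fun t => by
    linarith [min_add_max t 0]
  have hc : 0 ≤ (hmax + L) - (hmin - L) := by linarith
  have hup : F X - F Y ≤ ∑ j, ((hmin - L) * (eigs X j - eigs Y j)
      + ((hmax + L) - (hmin - L)) * max (eigs X j - eigs Y j) 0) := by
    rw [hFd]
    refine Finset.sum_le_sum fun j _ => ?_
    have hgj := abs_le.1 (hg (eigs X j) (eigs Y j))
    rcases le_total 0 (eigs X j - eigs Y j) with hd | hd
    · rw [max_eq_left hd]; rw [abs_of_nonneg hd] at hgj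
      nlinarith [mul_le_mul_of_nonneg_right (hhi j) hd]
    · rw [max_eq_right hd]; rw [abs_of_nonpos hd] at hgj
      nlinarith [mul_le_mul_of_nonpos_right (hlo j) hd]
  have hdown : ∑ j, ((hmax + L) * (eigs X j - eigs Y j)
      - ((hmax + L) - (hmin - L)) * max (eigs X j - eigs Y j) 0) ≤ F X - F Y := by
    rw [hFd]
    refine Finset.sum_le_sum fun j _ => ?_
    have hgj := abs_le.1 (hg (eigs X j) (eigs Y j))
    rcases le_total 0 (eigs X j - eigs Y j) with hd | hd
    · rw [max_eq_left hd]; rw [abs_of_nonneg hd] at hgj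
      nlinarith [mul_le_mul_of_nonneg_right (hlo j) hd]
    · rw [max_eq_right hd]; rw [abs_of_nonpos hd] at hgj
      nlinarith [mul_le_mul_of_nonpos_right (hhi j) hd]
  rw [Finset.sum_add_distrib, ← Finset.mul_sum, ← Finset.mul_sum, htr] at hup
  rw [Finset.sum_sub_distrib, ← Finset.mul_sum, ← Finset.mul_sum, htr] at hdown
  have k2 := mul_le_mul_of_nonneg_left key hc
  constructor
  · unfold pucciMinus
    simp only [hmm]
    rw [Finset.sum_add_distrib, ← Finset.mul_sum, ← Finset.mul_sum, Finset.sum_sub_distrib]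
    linarith
  · unfold pucciPlus
    simp only [hmm]
    rw [Finset.sum_add_distrib, ← Finset.mul_sum, ← Finset.mul_sum, Finset.sum_sub_distrib]
    linarith
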